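/- Let A be a Poisson algebra that is a ℚ-algebra and let a, b, c ∈ A[X]; set L(λ) = [[a, b],[c, −a]] and let d = −(a² + b·c) ∈ A[X] be its determinant polynomial. Suppose there exist 4×4 matrices D₁₂(λ,μ) and D₂₁(λ,μ) over A[λ,μ] such that, as an identity of 4×4 matrices over A[λ,μ], {L₁(λ) ⊗, L₂(μ)} = [D₁₂(λ,μ), L₁(λ)] + [D₂₁(λ,μ), L₂(μ)], where L₁(λ) = L(λ)⊗I and L₂(μ) = I⊗L(μ). Then: (1) the coefficients of d pairwise Poisson-commute, {d_i, d_j} = 0; (2) any two elements h, h' ∈ A with d(h) = d(h') = 0 and d'(h), d'(h') invertible satisfy {h, h'} = 0 — the zeros of the generating function of integrals of motion are themselves integrals in involution. -/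

import Mathlib

open Matrix Kronecker Polynomial

/-- A Poisson algebra: a commutative ring with an additive, antisymmetric bracket
satisfying the Jacobi identity and the Leibniz rule. -/
structure PoissonR (A : Type*) [CommRing A] where
  br : A → A → A
  add_left : ∀ x y z : A, br (x + y) z = br x z + br y z
  add_right : ∀ x y z : A, br x (y + z) = br x y + br x z
  antisymm : ∀ x y : A, br x y = - br y x
  jacobi : ∀ x y z : A, br x (br y z) + br y (br z x) + br z (br x y) = 0
  leibniz : ∀ x y z : A, br x (y * z) = br x y * z + y * br x z

variable {A : Type*} [CommRing A]

/-- The two-variable bracket `{p(λ), q(μ)} = Σ_{i,j} {p_i, q_j} λ^i μ^j ∈ A[λ,μ] = (A[μ])[λ]`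
(outer variable `λ`, inner variable `μ`). -/
noncomputable def br2 (P : PoissonR A) (p q : Polynomial A) :
    Polynomial (Polynomial A) :=
  ∑ i ∈ p.support, ∑ j ∈ q.support,
    Polynomial.C (Polynomial.C (P.br (p.coeff i) (q.coeff j)) * Polynomial.X ^ j)
      * Polynomial.X ^ i

/-- The tensor bracket `{L₁(λ) ⊗, L₂(μ)}` of a 2×2 polynomial matrix with itself. -/
noncomputable def tbr2 (P : PoissonR A) (L L' : Matrix (Fin 2) (Fin 2) (Polynomial A)) :
    Matrix (Fin 2 × Fin 2) (Fin 2 × Fin 2) (Polynomial (Polynomial A)) :=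
  Matrix.of fun p q => br2 P (L p.1 q.1) (L' p.2 q.2)

/-- Matrix commutator. -/
def mcomm {R ι : Type*} [CommRing R] [Fintype ι] [DecidableEq ι]
    (X Y : Matrix ι ι R) : Matrix ι ι R :=
  X * Y - Y * X

/-- The Hamiltonian derivation `{·, x}`. -/
noncomputable def PoissonR.ham (P : PoissonR A) (x : A) : Derivation ℤ A A :=
  Derivation.mk' (AddMonoidHom.mk' (fun y => P.br y x) fun y z => P.add_left y z x).toIntLinearMap
    fun y z => by
      change P.br (y * z) x = y * P.br z x + z * P.br y x
      rw [P.antisymm, P.leibniz, P.antisymm y, P.antisymm z]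
      ring

@[simp]
theorem PoissonR.ham_apply (P : PoissonR A) (x y : A) : P.ham x y = P.br y x := rfl

theorem PoissonR.br_zero_left (P : PoissonR A) (x : A) : P.br 0 x = 0 :=
  map_zero (P.ham x)

theorem PoissonR.br_zero_right (P : PoissonR A) (x : A) : P.br x 0 = 0 := by
  rw [P.antisymm, P.br_zero_left, neg_zero]

theorem coeff_coeff_br2 (P : PoissonR A) (p q : A[X]) (i j : ℕ) :
    ((br2 P p q).coeff i).coeff j = P.br (p.coeff i) (q.coeff j) := by
  simp only [br2, finsetSum_coeff, coeff_C_mul, coeff_X_pow, mul_ite, mul_one, mul_zero]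
  rw [Finset.sum_eq_single i]
  · rw [Finset.sum_eq_single j]
    · simp
    · intro k _ hk
      simp [coeff_X_pow, hk.symm]
    · intro hj
      simp [notMem_support_iff.mp hj, P.br_zero_right]
  · intro k _ hk
    simp [hk.symm]
  · intro hi
    simp [notMem_support_iff.mp hi, P.br_zero_left]

theorem br2_swap_coeff (P : PoissonR A) (p q : A[X]) (i j : ℕ) :
    ((br2 P p q).coeff i).coeff j = -((br2 P q p).coeff j).coeff i := by
  rw [coeff_coeff_br2, coeff_coeff_br2, P.antisymm]

theorem br2_add_left (P : PoissonR A) (p p' q : A[X]) :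
    br2 P (p + p') q = br2 P p q + br2 P p' q := by
  ext i j
  simp [coeff_coeff_br2, P.add_left]

theorem br2_add_right (P : PoissonR A) (p q q' : A[X]) :
    br2 P p (q + q') = br2 P p q + br2 P p q' := by
  ext i j
  simp [coeff_coeff_br2, P.add_right]

theorem br2_neg_left (P : PoissonR A) (p q : A[X]) : br2 P (-p) q = -br2 P p q := by
  ext i j
  simpa [coeff_coeff_br2] using map_neg (P.ham (q.coeff j)) (p.coeff i)

theorem br2_neg_right (P : PoissonR A) (p q : A[X]) : br2 P p (-q) = -br2 P p q := by
  ext i j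
  simp only [coeff_neg, br2_swap_coeff P p, br2_neg_left]

theorem br2_mul_left (P : PoissonR A) (p p' q : A[X]) :
    br2 P (p * p') q = p.map C * br2 P p' q + p'.map C * br2 P p q := by
  ext i j
  rw [mul_comm (p'.map C), coeff_coeff_br2, ← P.ham_apply, coeff_mul, map_sum]
  simp only [coeff_add, coeff_mul (p.map C), coeff_mul (br2 P p q), finsetSum_coeff, coeff_map,
    coeff_C_mul, coeff_mul_C, coeff_coeff_br2, ← Finset.sum_add_distrib]
  refine Finset.sum_congr rfl fun x _ => ?_
  rw [Derivation.leibniz]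
  simp only [P.ham_apply, smul_eq_mul]
  ring

theorem br2_mul_right (P : PoissonR A) (p q q' : A[X]) :
    br2 P p (q * q') = C q * br2 P p q' + C q' * br2 P p q := by
  ext i j
  rw [mul_comm (C q'), coeff_coeff_br2, P.antisymm, ← P.ham_apply, coeff_mul, map_sum]
  simp only [coeff_add, coeff_C_mul, coeff_mul_C]
  simp only [coeff_mul, coeff_coeff_br2, ← Finset.sum_add_distrib,
    ← Finset.sum_neg_distrib]
  refine Finset.sum_congr rfl fun x _ => ?_
  rw [Derivation.leibniz]
  simp only [P.ham_apply, smul_eq_mul, P.antisymm (p.coeff i)]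
  ring

/-- The trace of `X * Y` against `[D, X]` vanishes when `X` and `Y` commute. -/
theorem trace_mul_mcomm {R ι : Type*} [CommRing R] [Fintype ι] [DecidableEq ι]
    {X Y : Matrix ι ι R} (hXY : Commute X Y) (D : Matrix ι ι R) :
    trace (X * Y * mcomm D X) = 0 := by
  rw [mcomm, mul_sub, trace_sub, sub_eq_zero, ← mul_assoc, trace_mul_comm _ X, ← mul_assoc,
    ← mul_assoc, ← mul_assoc, mul_assoc X X Y, hXY.eq, ← mul_assoc, hXY.eq]

theorem br2_det_eq_trace (P : PoissonR A) (a b c : A[X]) :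
    br2 P (-(a ^ 2 + b * c)) (-(a ^ 2 + b * c)) =
      trace (((!![a, b; c, -a].map fun p => p.map C) ⊗ₖ (1 : Matrix (Fin 2) (Fin 2) A[X][X])) *
        ((1 : Matrix (Fin 2) (Fin 2) A[X][X]) ⊗ₖ (!![a, b; c, -a].map C)) *
        tbr2 P !![a, b; c, -a] !![a, b; c, -a]) := by
  rw [← mul_kronecker_mul]
  simp only [sq, br2_neg_left, br2_neg_right, br2_add_left, br2_add_right, br2_mul_left,
    br2_mul_right, mul_one, one_mul, trace, diag, mul_apply, Fintype.sum_prod_type,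
    Fin.sum_univ_two, kroneckerMap_apply, tbr2, of_apply, map_apply, cons_val_zero, cons_val_one,
    cons_val', cons_val_fin_one, Polynomial.map_neg, C_neg]
  ring

theorem br_eval_left (P : PoissonR A) (d : A[X]) (h x : A) :
    P.br (d.eval h) x =
      (d.sum fun i r => P.br r x * h ^ i) + (derivative d).eval h * P.br h x := by
  rw [← P.ham_apply, eval_eq_sum, Polynomial.sum, Polynomial.sum, map_sum, derivative_eval,
    Polynomial.sum, Finset.sum_mul, ← Finset.sum_add_distrib]
  refine Finset.sum_congr rfl fun i _ => ?_
  rw [Derivation.leibniz, Derivation.leibniz_pow]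
  simp only [P.ham_apply, smul_eq_mul, nsmul_eq_mul]
  ring

theorem br_eq_zero_of_simple_root (P : PoissonR A) {d : A[X]} {h x : A} (hh : d.eval h = 0)
    (hu : IsUnit ((derivative d).eval h)) (hx : ∀ i, P.br (d.coeff i) x = 0) :
    P.br h x = 0 := by
  have key := br_eval_left P d h x
  rw [hh, P.br_zero_left] at key
  simpa [Polynomial.sum, hx, hu.mul_right_eq_zero] using key.symm

/-- if `L(λ) = [[a,b],[c,−a]]` obeys a linear rs-type matrix algebra
`{L₁(λ) ⊗, L₂(μ)} = [D₁₂, L₁(λ)] + [D₂₁, L₂(μ)]`, then the coefficients of the determinant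
polynomial `d = −(a²+bc)` pairwise Poisson-commute, and any two nondegenerate zeros of `d`
are in involution. -/
theorem statement11 {A : Type*} [CommRing A] [Algebra ℚ A] (P : PoissonR A)
    (a b c : Polynomial A)
    (L : Matrix (Fin 2) (Fin 2) (Polynomial A)) (hL : L = !![a, b; c, -a])
    (d : Polynomial A) (hd : d = -(a ^ 2 + b * c))
    (D12 D21 : Matrix (Fin 2 × Fin 2) (Fin 2 × Fin 2) (Polynomial (Polynomial A)))
    (h : tbr2 P L L
      = mcomm D12 ((L.map fun p => p.map Polynomial.C) ⊗ₖ
          (1 : Matrix (Fin 2) (Fin 2) (Polynomial (Polynomial A))))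
        + mcomm D21 ((1 : Matrix (Fin 2) (Fin 2) (Polynomial (Polynomial A))) ⊗ₖ
          (L.map Polynomial.C))) :
    (∀ i j, P.br (d.coeff i) (d.coeff j) = 0) ∧
    (∀ h₁ h₂ : A, d.eval h₁ = 0 → d.eval h₂ = 0 →
      IsUnit ((Polynomial.derivative d).eval h₁) →
      IsUnit ((Polynomial.derivative d).eval h₂) →
      P.br h₁ h₂ = 0) := by
  subst hL hd
  have hcomm : Commute
      ((!![a, b; c, -a].map fun p => p.map C) ⊗ₖ (1 : Matrix (Fin 2) (Fin 2) A[X][X]))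
      ((1 : Matrix (Fin 2) (Fin 2) A[X][X]) ⊗ₖ (!![a, b; c, -a].map C)) := by
    rw [Commute, SemiconjBy, ← mul_kronecker_mul, ← mul_kronecker_mul]
    simp only [mul_one, one_mul]
  have hbr : br2 P (-(a ^ 2 + b * c)) (-(a ^ 2 + b * c)) = 0 := by
    rw [br2_det_eq_trace, h, mul_add, trace_add, trace_mul_mcomm hcomm, hcomm.eq,
      trace_mul_mcomm hcomm.symm, add_zero]
  have hinv : ∀ i j, P.br ((-(a ^ 2 + b * c)).coeff i) ((-(a ^ 2 + b * c)).coeff j) = 0 := by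
    intro i j
    rw [← coeff_coeff_br2, hbr, coeff_zero, coeff_zero]
  refine ⟨hinv, fun h₁ h₂ e₁ e₂ u₁ u₂ => br_eq_zero_of_simple_root P e₁ u₁ fun i => ?_⟩
  rw [P.antisymm, br_eq_zero_of_simple_root P e₂ u₂ fun k => hinv k i, neg_zero]
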